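/- Let M be the 6×6 matrix over ℤ[q] with rows: row 1: (q⁴+q³−q²−q, q³−q, q⁵−2q⁴−q³+2q², q⁵−q³, q⁶−2q⁵−q⁴+2q, −2q⁴−q³+2q²+q); row 2: (q³−q, q⁴+q³−q²−q, q⁵−q³, q⁵−2q⁴−q³+2q², q⁶−2q⁵−q⁴+2q, −2q⁴−q³+2q²+q); row 3: (q³−2q², q³, q⁵+q⁴−3q³+3q², q⁵−3q³, q⁶−2q⁵−3q⁴+4q³, −2q⁴+2q³); row 4: (q³, q³−2q², q⁵−3q³, q⁵+q⁴−3q³+3q², q⁶−2q⁵−3q⁴+4q³, −2q⁴+2q³); row 5: (q³, q³, q⁵−3q³, q⁵−3q³, q⁶−2q⁵−2q⁴+4q³+q², −2q⁴); row 6: (−1, −1, 2q², 2q², −4q²+2, q⁴−2q²+2q+1). For g ≥ 0 set v^g = M^g·(1,0,0,0,0,0)ᵗ and write v^g = (ẽ₀^g, ẽ₁^g, ẽ₂^g, ẽ₃^g, ã^g, b̃^g). For g ≥ 1 let m₃^g = (q²−1)(q³−q)^{2g−2} + (1/2)((q+1)(q²+q)^{2g−2} − (q−1)(q²−q)^{2g−2})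 in ℚ[q]. Then for every g ≥ 1, the identity ẽ₃^g = q·m₃^g holds in ℚ[q]. -/

import Mathlib

open Polynomial Matrix

noncomputable section

/-- The indeterminate `q` of `ℤ[q]`. -/
def q : Polynomial ℤ := Polynomial.X

/-- The transition matrix `M` of the genus-adding handle attachment. -/
def M : Matrix (Fin 6) (Fin 6) (Polynomial ℤ) :=
  !![q^4+q^3-q^2-q, q^3-q, q^5-2*q^4-q^3+2*q^2, q^5-q^3, q^6-2*q^5-q^4+2*q, -2*q^4-q^3+2*q^2+q;
     q^3-q, q^4+q^3-q^2-q, q^5-q^3, q^5-2*q^4-q^3+2*q^2, q^6-2*q^5-q^4+2*q, -2*q^4-q^3+2*q^2+q;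
     q^3-2*q^2, q^3, q^5+q^4-3*q^3+3*q^2, q^5-3*q^3, q^6-2*q^5-3*q^4+4*q^3, -2*q^4+2*q^3;
     q^3, q^3-2*q^2, q^5-3*q^3, q^5+q^4-3*q^3+3*q^2, q^6-2*q^5-3*q^4+4*q^3, -2*q^4+2*q^3;
     q^3, q^3, q^5-3*q^3, q^5-3*q^3, q^6-2*q^5-2*q^4+4*q^3+q^2, -2*q^4;
     -1, -1, 2*q^2, 2*q^2, -4*q^2+2, q^4-2*q^2+2*q+1]

/-- `v g = M^g · (1,0,0,0,0,0)ᵗ`, whose components are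
`(ẽ₀^g, ẽ₁^g, ẽ₂^g, ẽ₃^g, ã^g, b̃^g)`. -/
def v (g : ℕ) : Fin 6 → Polynomial ℤ :=
  (M ^ g).mulVec ![1, 0, 0, 0, 0, 0]

/-- The indeterminate `q` of `ℚ[q]`. -/
def x : Polynomial ℚ := Polynomial.X

/-- `m₃^g`, the E-polynomial of the character variety `M_{J₋}^g`. -/
def m3 (g : ℕ) : Polynomial ℚ :=
  (x^2-1)*(x^3-x)^(2*g-2)
    + C (1/2 : ℚ) * ((x+1)*(x^2+x)^(2*g-2) - (x-1)*(x^2-x)^(2*g-2))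

lemma v_succ (g : ℕ) : v (g + 1) = M.mulVec (v g) := by
  simp only [v, pow_succ', Matrix.mulVec_mulVec]

/-- Twice the decomposition of `v (n + 1)` into eigenvectors of `M`. -/
lemma two_mul_v_succ (n : ℕ) :
    2 * v (n + 1) 0 = 2*(q^3-q)*((q^3-q)^2)^n + (q^4-q^2)*((q^2+q)^2)^n + (q^4-2*q^3-q^2+2*q)*((q^2-q)^2)^n + 2*(q^3-q)*((q^2-1)^2)^n ∧
    2 * v (n + 1) 1 = 2*(q^3-q)*((q^3-q)^2)^n + (q-q^3)*((q^2+q)^2)^n + (q-q^3)*((q^2-q)^2)^n + 2*(q^3-q)*((q^2-1)^2)^n ∧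
    2 * v (n + 1) 2 = 2*(q^3-q)*((q^3-q)^2)^n - (q^3+q^2)*((q^2+q)^2)^n + (q^3-3*q^2+2*q)*((q^2-q)^2)^n ∧
    2 * v (n + 1) 3 = 2*(q^3-q)*((q^3-q)^2)^n + (q^2+q)*((q^2+q)^2)^n + (q-q^2)*((q^2-q)^2)^n ∧
    2 * v (n + 1) 4 = 2*(q^3-q)*((q^3-q)^2)^n + (q^2+q)*((q^2+q)^2)^n + (q-q^2)*((q^2-q)^2)^n ∧
    2 * v (n + 1) 5 = -(q^2+q)*((q^2+q)^2)^n + (q-q^2)*((q^2-q)^2)^n + 2*(q^2-1)*((q^2-1)^2)^n := by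
  induction n with
  | zero =>
    rw [v_succ]
    refine ⟨?_, ?_, ?_, ?_, ?_, ?_⟩ <;>
      simp [v, M, Matrix.mulVec, dotProduct, Fin.sum_univ_six] <;> ring
  | succ n ih =>
    obtain ⟨h0, h1, h2, h3, h4, h5⟩ := ih
    have key (i : Fin 6) : 2 * v (n + 1 + 1) i =
        M i 0 * (2 * v (n + 1) 0) + M i 1 * (2 * v (n + 1) 1) + M i 2 * (2 * v (n + 1) 2) +
        M i 3 * (2 * v (n + 1) 3) + M i 4 * (2 * v (n + 1) 4) + M i 5 * (2 * v (n + 1) 5) := by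
      rw [v_succ (n + 1)]
      simp only [Matrix.mulVec, dotProduct, Fin.sum_univ_six]
      ring
    simp only [h0, h1, h2, h3, h4, h5] at key
    simp only [pow_succ (_ ^ 2) n]
    generalize ((q^3-q)^2)^n = a at *
    generalize ((q^2+q)^2)^n = b at *
    generalize ((q^2-q)^2)^n = c at *
    generalize ((q^2-1)^2)^n = d at *
    refine ⟨?_, ?_, ?_, ?_, ?_, ?_⟩ <;> rw [key] <;>
      simp only [M, Matrix.of_apply, Matrix.cons_val] <;> ring

theorem stmt_10 (g : ℕ) (hg : 1 ≤ g) :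
    (v g 3).map (Int.castRingHom ℚ) = x * m3 g := by
  obtain ⟨n, rfl⟩ : ∃ n, g = n + 1 := ⟨g - 1, by omega⟩
  obtain ⟨-, -, -, h, -, -⟩ := two_mul_v_succ n
  replace h := congrArg (Polynomial.map (Int.castRingHom ℚ)) h
  simp only [q, Polynomial.map_add, Polynomial.map_sub, Polynomial.map_mul, Polynomial.map_pow,
    Polynomial.map_X, Polynomial.map_ofNat] at h
  have half : C (1/2 : ℚ) * 2 = 1 := by
    rw [← C_ofNat, ← C_mul]
    norm_num
  rw [m3, show 2 * (n + 1) - 2 = 2 * n by omega, x]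
  simp only [pow_mul]
  linear_combination C (1/2 : ℚ) * h +
    (X * (X^2-1) * ((X^3-X)^2)^n - (v (n + 1) 3).map (Int.castRingHom ℚ)) * half
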